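/- For every integer n ≥ 1 the quantities c_{i,j} satisfy: c_{1,1}(4n) = a_{2,1}(4n); c_{1,2}(4n) = a_{2,2}(4n); c_{2,1}(4n) = a_{2,1}(2n)+a_{1,2}(2n)+c_{2,1}(2n)+a_{2,2}(2n+1); c_{2,2}(4n) = a_{2,2}(4n+1); c_{1,1}(4n+1) = a_{2,1}(4n+1); c_{1,2}(4n+1) = a_{2,2}(4n+1); c_{2,1}(4n+1) = a_{2,1}(4n+2); c_{2,2}(4n+1) = 2·a_{1,2}(2n)+2·a_{2,2}(2n+1); c_{1,1}(4n+2) = a_{2,1}(4n+2); c_{1,2}(4n+2) = a_{2,2}(4n+2); c_{2,1}(4n+2) = a_{1,1}(2n+2)+2·a_{2,2}(2n+1)+a_{2,1}(2n+2); c_{2,2}(4n+2) = a_{2,2}(4n+3); c_{1,1}(4n+3) = a_{2,1}(4n+3); c_{1,2}(4n+3) = a_{2,2}(4n+3); c_{2,1}(4n+3) = 2·a_{2,1}(2n+2)+2·a_{1,2}(2n+2); c_{2,2}(4n+3) = 2·a_{2,2}(2n+1)+2·a_{1,2}(2n+2). -/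

import Mathlib

/-- The 16-letter alphabet 𝒜 = {A,…,P}. -/
inductive A16 : Type
  | A | B | C | D | E | F | G | H | I | J | K | L | M | N | O | P
  deriving DecidableEq

/-- The 2×2 block substitution μ on 𝒜 (rows top to bottom). -/
def mu : A16 → Fin 2 → Fin 2 → A16
  | .A => ![![.A, .F], ![.G, .C]]
  | .B => ![![.A, .F], ![.H, .D]]
  | .C => ![![.B, .E], ![.G, .C]]
  | .D => ![![.B, .E], ![.H, .D]]
  | .E => ![![.A, .N], ![.G, .K]]
  | .F => ![![.A, .N], ![.H, .L]]
  | .G => ![![.B, .M], ![.G, .K]]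
  | .H => ![![.B, .M], ![.H, .L]]
  | .I => ![![.I, .F], ![.O, .C]]
  | .J => ![![.I, .F], ![.P, .D]]
  | .K => ![![.J, .E], ![.O, .C]]
  | .L => ![![.J, .E], ![.P, .D]]
  | .M => ![![.I, .N], ![.O, .K]]
  | .N => ![![.I, .N], ![.P, .L]]
  | .O => ![![.J, .M], ![.O, .K]]
  | .P => ![![.J, .M], ![.P, .L]]

/-- Entry version of μ, indexed by arbitrary naturals (via mod 2). -/
def muE (x : A16) (r c : ℕ) : A16 :=
  mu x ⟨r % 2, by omega⟩ ⟨c % 2, by omega⟩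

/-- `superE n x` is the supertile μⁿ(x), a 2ⁿ×2ⁿ array over 𝒜,
given as a total function on ℕ × ℕ (only indices < 2ⁿ are relevant). -/
def superE : ℕ → A16 → ℕ → ℕ → A16
  | 0, x, _, _ => x
  | n + 1, x, r, c => muE (superE n x (r / 2) (c / 2)) r c

/-- The supertile T_k = μᵏ(N). -/
def Tfun (k : ℕ) : ℕ → ℕ → A16 := superE k .N

/-- An m×n pattern over the alphabet α. -/
abbrev Pat (α : Type) (m n : ℕ) := Fin m → Fin n → α

/-- The set of m×n patterns occurring in the size×size array X. -/
def patIn {α : Type} (X : ℕ → ℕ → α) (size m n : ℕ) : Set (Pat α m n) :=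
  { p | ∃ r c : ℕ, r + m ≤ size ∧ c + n ≤ size ∧
      ∀ (i : Fin m) (j : Fin n), p i j = X (r + i) (c + j) }

/-- P(T, m×n) = ⋃ₖ P(T_k, m×n). -/
def PT (m n : ℕ) : Set (Pat A16 m n) := ⋃ k : ℕ, patIn (Tfun k) (2 ^ k) m n

/-- μ applied to an m×n pattern, as a total 2m×2n array on ℕ × ℕ
(indices are reduced mod the valid range; in range this is exactly μ(p)). -/
def muPatE {m n : ℕ} (p : Pat A16 m n) (r c : ℕ) : A16 :=
  if hm : 0 < m then
    if hn : 0 < n then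
      muE (p ⟨r / 2 % m, Nat.mod_lt _ hm⟩ ⟨c / 2 % n, Nat.mod_lt _ hn⟩) r c
    else .A
  else .A

/-- μ² applied to an m×n pattern, as a total 4m×4n array on ℕ × ℕ. -/
def mu2PatE {m n : ℕ} (p : Pat A16 m n) (r c : ℕ) : A16 :=
  muE (muPatE p (r / 2) (c / 2)) r c

/-- P_{i,j}(T, m×n) = { μ(x)[i,j,m×n] : x ∈ P(T,m×n) } (1-based corner (i,j)). -/
def Pij (i j m n : ℕ) : Set (Pat A16 m n) :=
  { q | ∃ x ∈ PT m n, ∀ (a : Fin m) (b : Fin n),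
      q a b = muPatE x (i - 1 + a) (j - 1 + b) }

/-- Q_{i,j}(T, m×n) = { μ²(x)[i,j,m×n] : x ∈ P(T,m×n) } (1-based corner (i,j)). -/
def Qij (i j m n : ℕ) : Set (Pat A16 m n) :=
  { q | ∃ x ∈ PT m n, ∀ (a : Fin m) (b : Fin n),
      q a b = mu2PatE x (i - 1 + a) (j - 1 + b) }

/-- The 2×2 block substitution φ from 𝒜 to ℬ = {0,1,2,3}. -/
def phi : A16 → Fin 2 → Fin 2 → Fin 4
  | .A => ![![0, 1], ![0, 0]]
  | .B => ![![0, 1], ![1, 1]]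
  | .C => ![![1, 0], ![0, 0]]
  | .D => ![![1, 0], ![1, 1]]
  | .E => ![![0, 3], ![0, 2]]
  | .F => ![![0, 3], ![1, 3]]
  | .G => ![![1, 2], ![0, 2]]
  | .H => ![![1, 2], ![1, 3]]
  | .I => ![![2, 1], ![2, 0]]
  | .J => ![![2, 1], ![3, 1]]
  | .K => ![![3, 0], ![2, 0]]
  | .L => ![![3, 0], ![3, 1]]
  | .M => ![![2, 3], ![2, 2]]
  | .N => ![![2, 3], ![3, 3]]
  | .O => ![![3, 2], ![2, 2]]
  | .P => ![![3, 2], ![3, 3]]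

/-- Entry version of φ, indexed by arbitrary naturals (via mod 2). -/
def phiE (x : A16) (r c : ℕ) : Fin 4 :=
  phi x ⟨r % 2, by omega⟩ ⟨c % 2, by omega⟩

/-- φ applied to an m×n pattern over 𝒜, as a total 2m×2n array on ℕ × ℕ. -/
def phiPatE {m n : ℕ} (p : Pat A16 m n) (r c : ℕ) : Fin 4 :=
  if hm : 0 < m then
    if hn : 0 < n then
      phiE (p ⟨r / 2 % m, Nat.mod_lt _ hm⟩ ⟨c / 2 % n, Nat.mod_lt _ hn⟩) r c
    else 0
  else 0

/-- φ(T_k), a 2^(k+1)×2^(k+1) array over ℬ. -/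
def Sfun (k : ℕ) (r c : ℕ) : Fin 4 := phiE (Tfun k (r / 2) (c / 2)) r c

/-- P(S, m×n) = ⋃_{k≥1} P(φ(T_{k-1}), m×n). -/
def PS (m n : ℕ) : Set (Pat (Fin 4) m n) :=
  ⋃ k : ℕ, patIn (Sfun k) (2 ^ (k + 1)) m n

/-- P_{i,j}(S, m×n) = { φ(x)[i,j,m×n] : x ∈ P(T,m×n) } (1-based corner (i,j)). -/
def PSij (i j m n : ℕ) : Set (Pat (Fin 4) m n) :=
  { q | ∃ x ∈ PT m n, ∀ (a : Fin m) (b : Fin n),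
      q a b = phiPatE x (i - 1 + a) (j - 1 + b) }

/-- A_n = |P(S, n×n)|. -/
noncomputable def Acnt (n : ℕ) : ℕ := Nat.card (PS n n)

/-- a_{i,j}(n) = |P_{i,j}(T, n×n)|. -/
noncomputable def aT (i j n : ℕ) : ℕ := Nat.card (Pij i j n n)

/-- b_{i,j}(n) = |P_{i,j}(T, n×(n+1))|. -/
noncomputable def bT (i j n : ℕ) : ℕ := Nat.card (Pij i j n (n + 1))

/-- c_{i,j}(n) = |P_{i,j}(T, (n+1)×n)|. -/
noncomputable def cT (i j n : ℕ) : ℕ := Nat.card (Pij i j (n + 1) n)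

/-- The letter of 𝒜 encoding the parities of its row and of its column counted from the right,
together with two further bits `u` and `v`. -/
def letterOfBits : Bool → Bool → Bool → Bool → A16
  | false, false, false, false => .E
  | false, false, false, true => .F
  | false, false, true, false => .M
  | false, false, true, true => .N
  | false, true, false, false => .A
  | false, true, false, true => .B
  | false, true, true, false => .I
  | false, true, true, true => .J
  | true, false, false, false => .C
  | true, false, false, true => .D
  | true, false, true, false => .K
  | true, false, true, true => .L
  | true, true, false, false => .G
  | true, true, false, true => .H
  | true, true, true, false => .O
  | true, true, true, true => .P

/-- First bit of the letter in row `r` and column `x` of T, columns being counted from the right. -/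
def uBit (r x : ℕ) : Bool :=
  if x % 2 = 0 then decide ((r / 2 + x / 2) % 2 = 0) else uBit (r / 2) (x / 2)
termination_by x
decreasing_by omega

/-- Second bit of the letter in row `r` and column `x` of T, columns being counted from the
right. -/
def vBit (r x : ℕ) : Bool :=
  if r % 2 = 0 then decide ((r / 2 + x) % 2 = 0) else vBit (r / 2) (x / 2)
termination_by r
decreasing_by omega

/-- The letter in row `r` and column `x` of T, columns being counted from the right. -/
def letterAt (r x : ℕ) : A16 :=
  letterOfBits (decide (r % 2 = 1)) (decide (x % 2 = 1)) (uBit r x) (vBit r x)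

theorem uBit_of_even {r x : ℕ} (h : x % 2 = 0) :
    uBit r x = decide ((r / 2 + x / 2) % 2 = 0) := by
  rw [uBit, if_pos h]

theorem uBit_of_odd {r x : ℕ} (h : x % 2 = 1) : uBit r x = uBit (r / 2) (x / 2) := by
  rw [uBit, if_neg (by omega)]

theorem vBit_of_even {r x : ℕ} (h : r % 2 = 0) : vBit r x = decide ((r / 2 + x) % 2 = 0) := by
  rw [vBit, if_pos h]

theorem vBit_of_odd {r x : ℕ} (h : r % 2 = 1) : vBit r x = vBit (r / 2) (x / 2) := by
  rw [vBit, if_neg (by omega)]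

/-- Each row of `uBit` is determined by the previous rows of `uBit` and `vBit`. -/
theorem uBit_succ (r x : ℕ) : uBit (r + 1) x = (uBit r x ^^ (vBit r x == vBit r (x + 1))) := by
  induction r using Nat.strong_induction_on generalizing x with
  | _ r ih =>
    rcases Nat.mod_two_eq_zero_or_one r with hr | hr
    · have hu : uBit (r + 1) x = uBit r x := by
        have h : (r + 1) / 2 = r / 2 := by omega
        rcases Nat.mod_two_eq_zero_or_one x with hx | hx
        · rw [uBit_of_even hx, uBit_of_even hx, h]
        · rw [uBit_of_odd hx, uBit_of_odd hx, h]
      have hv : vBit r (x + 1) = !vBit r x := by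
        rw [vBit_of_even hr, vBit_of_even hr, ← decide_not, decide_eq_decide]
        omega
      rw [hu, hv]
      simp
    · rw [vBit_of_odd hr, vBit_of_odd hr]
      rcases Nat.mod_two_eq_zero_or_one x with hx | hx
      · have hu : uBit (r + 1) x = !uBit r x := by
          rw [uBit_of_even hx, uBit_of_even hx, ← decide_not, decide_eq_decide]
          omega
        have h : (x + 1) / 2 = x / 2 := by omega
        rw [hu, h]
        simp
      · have h : (r + 1) / 2 = r / 2 + 1 := by omega
        have h' : (x + 1) / 2 = x / 2 + 1 := by omega
        rw [uBit_of_odd hx, uBit_of_odd hx, h, h']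
        exact ih _ (by omega) _

theorem uBit_add_two_pow (K r x : ℕ) (hx : x + 1 < 2 ^ K) :
    uBit r (x + 2 ^ (K + 1)) = uBit r x := by
  induction K generalizing r x with
  | zero => omega
  | succ K ih =>
    rw [pow_succ] at hx
    have h : (x + 2 ^ (K + 1 + 1)) / 2 = x / 2 + 2 ^ (K + 1) := by omega
    have h2 : 2 ^ (K + 1) = 2 * 2 ^ K := by ring
    rcases Nat.mod_two_eq_zero_or_one x with hx' | hx'
    · rw [uBit_of_even hx', uBit_of_even (by omega), decide_eq_decide]
      omega
    · rw [uBit_of_odd hx', uBit_of_odd (by omega), h, ih _ _ (by omega)]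

theorem vBit_add_two_pow (K r x : ℕ) (hr : r + 1 < 2 ^ K) :
    vBit r (x + 2 ^ (K + 1)) = vBit r x := by
  induction K generalizing r x with
  | zero => omega
  | succ K ih =>
    rw [pow_succ] at hr
    have h : (x + 2 ^ (K + 1 + 1)) / 2 = x / 2 + 2 ^ (K + 1) := by omega
    rcases Nat.mod_two_eq_zero_or_one r with hr' | hr'
    · rw [vBit_of_even hr', vBit_of_even hr', decide_eq_decide]
      omega
    · rw [vBit_of_odd hr', vBit_of_odd hr', h, ih _ _ (by omega)]

theorem letterAt_add_two_pow (K r x : ℕ) (hr : r + 1 < 2 ^ K) (hx : x + 1 < 2 ^ K) :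
    letterAt r (x + 2 ^ (K + 1)) = letterAt r x := by
  have h : (x + 2 ^ (K + 1)) % 2 = x % 2 := by omega
  rw [letterAt, letterAt, uBit_add_two_pow K r x hx, vBit_add_two_pow K r x hr, h]

theorem mu_letterOfBits (a b u v : Bool) (i j : Fin 2) :
    mu (letterOfBits a b u v) i j =
      letterOfBits (decide (i = 1)) (decide (j = 0)) (if j = 1 then a == b else u)
        (if i = 0 then a == decide (j = 0) else v) := by
  revert a b u v i j
  decide

theorem letterOfBits_inj {a b u v u' v' : Bool} :
    letterOfBits a b u v = letterOfBits a b u' v' ↔ u = u' ∧ v = v' := by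
  revert a b u v u' v'
  decide

theorem muE_letterAt {r x i j : ℕ} (hi : i % 2 = r % 2) (hj : j % 2 + x % 2 = 1) :
    muE (letterAt (r / 2) (x / 2)) i j = letterAt r x := by
  have hu : uBit r x = if x % 2 = 0 then decide (r / 2 % 2 = 1) == decide (x / 2 % 2 = 1)
      else uBit (r / 2) (x / 2) := by
    split_ifs with h
    · rw [uBit_of_even h, Bool.eq_iff_iff]
      simp only [decide_eq_true_eq, beq_iff_eq, decide_eq_decide]
      omega
    · exact uBit_of_odd (by omega)
  have hv : vBit r x = if r % 2 = 0 then decide (r / 2 % 2 = 1) == decide (x % 2 = 1)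
      else vBit (r / 2) (x / 2) := by
    split_ifs with h
    · rw [vBit_of_even h, Bool.eq_iff_iff]
      simp only [decide_eq_true_eq, beq_iff_eq, decide_eq_decide]
      omega
    · exact vBit_of_odd (by omega)
  rw [letterAt, letterAt, muE, mu_letterOfBits, hu, hv]
  rcases Nat.mod_two_eq_zero_or_one r with hr | hr <;>
    rcases Nat.mod_two_eq_zero_or_one x with hx | hx <;>
    simp [hi, hr, hx, show j % 2 = 1 - x % 2 by omega]

theorem Tfun_eq_letterAt (k r x : ℕ) (hr : r < 2 ^ k) (hx : x < 2 ^ k) :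
    Tfun k r (2 ^ k - 1 - x) = letterAt r x := by
  induction k generalizing r x with
  | zero =>
    obtain rfl : r = 0 := by omega
    obtain rfl : x = 0 := by omega
    simp [Tfun, superE, letterAt, letterOfBits, uBit, vBit]
  | succ k ih =>
    rw [pow_succ] at hr hx
    have h : (2 ^ (k + 1) - 1 - x) / 2 = 2 ^ k - 1 - x / 2 := by omega
    have ih' := ih (r / 2) (x / 2) (by omega) (by omega)
    rw [Tfun] at ih' ⊢
    rw [superE, h, ih', muE_letterAt rfl (by omega)]

/-- The `m × n` array of letters whose upper-left corner lies in row `r` and whose last column is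
column `e` from the right. -/
def window (m n r e : ℕ) : Pat A16 m n := fun i j => letterAt (r + i) (e + (n - 1 - j))

theorem mem_PT_iff {m n : ℕ} (p : Pat A16 m n) : p ∈ PT m n ↔ ∃ r e : ℕ, p = window m n r e := by
  simp only [PT, Set.mem_iUnion, patIn, Set.mem_ofPred_eq]
  constructor
  · rintro ⟨k, r, c, hr, hc, h⟩
    refine ⟨r, 2 ^ k - (c + n), funext fun i => funext fun j => ?_⟩
    rw [h, window, ← Tfun_eq_letterAt k _ _ (by omega) (by omega)]
    congr 1
    omega
  · rintro ⟨r, e, rfl⟩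
    have hk : r + m + e + n < 2 ^ (r + m + e + n) := Nat.lt_two_pow_self
    refine ⟨r + m + e + n, r, 2 ^ (r + m + e + n) - (e + n), by omega, by omega, fun i j => ?_⟩
    rw [window, ← Tfun_eq_letterAt (r + m + e + n) _ _ (by omega) (by omega)]
    congr 1
    omega

theorem muPatE_window {m n i j : ℕ} (r e : ℕ) (hi : i = 1 ∨ i = 2) (hj : j = 1 ∨ j = 2)
    (a : Fin m) (b : Fin n) :
    muPatE (window m n r e) (i - 1 + a) (j - 1 + b) =
      window m n (2 * r + (i - 1)) (2 * e + (n + 1 - j)) a b := by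
  have ha : (i - 1 + a) / 2 % m = (i - 1 + a) / 2 := Nat.mod_eq_of_lt (by omega)
  have hb : (j - 1 + b) / 2 % n = (j - 1 + b) / 2 := Nat.mod_eq_of_lt (by omega)
  have hr : r + (i - 1 + a) / 2 % m = (2 * r + (i - 1) + a) / 2 := by omega
  have he : e + (n - 1 - (j - 1 + b) / 2 % n) = (2 * e + (n + 1 - j) + (n - 1 - b)) / 2 := by omega
  rw [muPatE, dif_pos (by omega), dif_pos (by omega)]
  simp only [window, hr, he]
  exact muE_letterAt (by omega) (by omega)

theorem exists_window_shift (m n r e N : ℕ) :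
    ∃ s, N ≤ s ∧ window m n r (e + 2 * s) = window m n r e := by
  have hk : r + m + e + n + N + 1 < 2 ^ (r + m + e + n + N + 1) := Nat.lt_two_pow_self
  refine ⟨2 ^ (r + m + e + n + N + 1), by omega, funext fun i => funext fun j => ?_⟩
  rw [window, window, ← letterAt_add_two_pow (r + m + e + n + N + 1) _ (e + _)
    (by omega) (by omega), pow_succ' 2 (r + m + e + n + N + 1)]
  congr 1
  omega

theorem Pij_eq_range {i j : ℕ} (m n : ℕ) (hi : i = 1 ∨ i = 2) (hj : j = 1 ∨ j = 2) :
    Pij i j m n = Set.range fun p : ℕ × ℕ =>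
      window m n (2 * p.1 + (i - 1)) (2 * p.2 + (n + 1 - j) % 2) := by
  ext q
  simp only [Pij, Set.mem_ofPred_eq, mem_PT_iff, Set.mem_range, Prod.exists]
  constructor
  · rintro ⟨x, ⟨r, e, rfl⟩, h⟩
    refine ⟨r, e + (n + 1 - j) / 2, funext fun a => funext fun b => ?_⟩
    rw [h, muPatE_window r e hi hj]
    congr 1
    omega
  · rintro ⟨r, e, rfl⟩
    obtain ⟨s, hs, h⟩ := exists_window_shift m n (2 * r + (i - 1)) (2 * e + (n + 1 - j) % 2) n
    refine ⟨_, ⟨r, e + s - (n + 1 - j) / 2, rfl⟩, fun a b => ?_⟩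
    rw [muPatE_window _ _ hi hj, ← h]
    congr 1
    omega

/-- Two positions see the same `vBit`s on their windows with `h'` rows and `w'` columns, and the same
`uBit`s on their windows with `h` rows and `w` columns. -/
def SameBits (h' h w' w : ℕ) (p q : ℕ × ℕ) : Prop :=
  (∀ i < h', ∀ j < w', vBit (p.1 + i) (p.2 + j) = vBit (q.1 + i) (q.2 + j)) ∧
    ∀ i < h, ∀ j < w, uBit (p.1 + i) (p.2 + j) = uBit (q.1 + i) (q.2 + j)

theorem window_eq_iff {m n r e r' e' : ℕ} (hr : r % 2 = r' % 2) (he : e % 2 = e' % 2) :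
    window m n r e = window m n r' e' ↔ SameBits m m n n (r, e) (r', e') := by
  have key (i j : ℕ) : letterAt (r + i) (e + j) = letterAt (r' + i) (e' + j) ↔
      vBit (r + i) (e + j) = vBit (r' + i) (e' + j) ∧
        uBit (r + i) (e + j) = uBit (r' + i) (e' + j) := by
    rw [letterAt, letterAt, show (r + i) % 2 = (r' + i) % 2 by omega,
      show (e + j) % 2 = (e' + j) % 2 by omega, letterOfBits_inj, and_comm]
  simp only [SameBits, funext_iff, Fin.forall_iff, window, key]
  constructor
  · intro h
    have h' (i : ℕ) (hi : i < m) (j : ℕ) (hj : j < n) := h i hi (n - 1 - j) (by omega)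
    refine ⟨fun i hi j hj => ?_, fun i hi j hj => ?_⟩ <;>
    · have := h' i hi j hj
      rw [show n - 1 - (n - 1 - j) = j by omega] at this
      first | exact this.1 | exact this.2
  · intro h i hi j hj
    exact ⟨h.1 i hi _ (by omega), h.2 i hi _ (by omega)⟩

/-- The parities of a position, the `vBit`s on its window with `h'` rows and `w'` columns, and the
`uBit`s on its window with `h` rows and `w` columns. -/
def bitData (h' h w' w : ℕ) (p : ℕ × ℕ) :
    (Bool × Bool) × (Fin h' → Fin w' → Bool) × (Fin h → Fin w → Bool) :=
  ((decide (p.1 % 2 = 1), decide (p.2 % 2 = 1)),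
    fun i j => vBit (p.1 + i) (p.2 + j), fun i j => uBit (p.1 + i) (p.2 + j))

theorem bitData_eq_iff {h' h w' w : ℕ} {p q : ℕ × ℕ} :
    bitData h' h w' w p = bitData h' h w' w q ↔
      p.1 % 2 = q.1 % 2 ∧ p.2 % 2 = q.2 % 2 ∧ SameBits h' h w' w p q := by
  simp only [bitData, SameBits, Prod.mk.injEq, decide_eq_decide, funext_iff, Fin.forall_iff]
  have (a b : ℕ) : (a % 2 = 1 ↔ b % 2 = 1) ↔ a % 2 = b % 2 := by omega
  rw [this, this]
  tauto

/-- Number of different values of `bitData`. -/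
noncomputable def bitCount (h' h w' w : ℕ) : ℕ := (Set.range (bitData h' h w' w)).ncard

theorem ncard_range_congr {ι α β : Type*} {f : ι → α} {g : ι → β}
    (h : ∀ p q, f p = f q ↔ g p = g q) : (Set.range f).ncard = (Set.range g).ncard := by
  rw [← Nat.card_coe_set_eq, ← Nat.card_coe_set_eq,
    ← Nat.card_congr (Setoid.quotientKerEquivRange f),
    ← Nat.card_congr (Setoid.quotientKerEquivRange g)]
  have : Setoid.ker f = Setoid.ker g := Setoid.ext h
  rw [this]

theorem vBit_double_of_even {a e i j : ℕ} (h : i % 2 = 0) :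
    vBit (2 * a + i) (2 * e + j) = decide ((a + i / 2 + j) % 2 = 0) := by
  rw [vBit_of_even (by omega), decide_eq_decide]
  omega

theorem vBit_double_of_odd {a e i j : ℕ} (h : i % 2 = 1) :
    vBit (2 * a + i) (2 * e + j) = vBit (a + i / 2) (e + j / 2) := by
  rw [vBit_of_odd (by omega), Nat.mul_add_div two_pos, Nat.mul_add_div two_pos]

theorem uBit_double_of_even {a e i j : ℕ} (h : j % 2 = 0) :
    uBit (2 * a + i) (2 * e + j) = decide ((a + i / 2 + (e + j / 2)) % 2 = 0) := by
  rw [uBit_of_even (by omega), Nat.mul_add_div two_pos, Nat.mul_add_div two_pos]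

theorem uBit_double_of_odd {a e i j : ℕ} (h : j % 2 = 1) :
    uBit (2 * a + i) (2 * e + j) = uBit (a + i / 2) (e + j / 2) := by
  rw [uBit_of_odd (by omega), Nat.mul_add_div two_pos, Nat.mul_add_div two_pos]

theorem sameBits_double_iff {h' h w' w ε δ : ℕ} (hh' : 2 ≤ h') (hh : 1 ≤ h) (hw' : 1 ≤ w')
    (hw : 2 ≤ w) (hε : ε < 2) (hδ : δ < 2) (p q : ℕ × ℕ) :
    SameBits h' h w' w (2 * p.1 + ε, 2 * p.2 + δ) (2 * q.1 + ε, 2 * q.2 + δ) ↔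
      bitData ((h' + ε) / 2) ((h + ε + 1) / 2) ((w' + δ + 1) / 2) ((w + δ) / 2) p =
        bitData ((h' + ε) / 2) ((h + ε + 1) / 2) ((w' + δ + 1) / 2) ((w + δ) / 2) q := by
  rw [bitData_eq_iff]
  obtain ⟨a, e⟩ := p
  obtain ⟨a', e'⟩ := q
  simp only [SameBits, add_assoc (2 * _)]
  constructor
  · rintro ⟨hv, hu⟩
    have ha : a % 2 = a' % 2 := by
      have := hv ε (by omega) 0 (by omega)
      rw [vBit_double_of_even (by omega), vBit_double_of_even (by omega),
        decide_eq_decide] at this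
      omega
    have he : e % 2 = e' % 2 := by
      have := hu 0 (by omega) δ (by omega)
      rw [uBit_double_of_even (by omega), uBit_double_of_even (by omega),
        decide_eq_decide] at this
      omega
    refine ⟨ha, he, fun i hi j hj => ?_, fun i hi j hj => ?_⟩
    · have := hv (2 * i + 1 - ε) (by omega) (2 * j - δ) (by omega)
      rwa [vBit_double_of_odd (by omega), vBit_double_of_odd (by omega),
        show (ε + (2 * i + 1 - ε)) / 2 = i by omega,
        show (δ + (2 * j - δ)) / 2 = j by omega] at this
    · have := hu (2 * i - ε) (by omega) (2 * j + 1 - δ) (by omega)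
      rwa [uBit_double_of_odd (by omega), uBit_double_of_odd (by omega),
        show (ε + (2 * i - ε)) / 2 = i by omega,
        show (δ + (2 * j + 1 - δ)) / 2 = j by omega] at this
  · rintro ⟨ha, he, hv, hu⟩
    refine ⟨fun i hi j hj => ?_, fun i hi j hj => ?_⟩
    · rcases Nat.mod_two_eq_zero_or_one (ε + i) with hp | hp
      · rw [vBit_double_of_even hp, vBit_double_of_even hp, decide_eq_decide]
        omega
      · rw [vBit_double_of_odd hp, vBit_double_of_odd hp]
        exact hv _ (by omega) _ (by omega)
    · rcases Nat.mod_two_eq_zero_or_one (δ + j) with hp | hp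
      · rw [uBit_double_of_even hp, uBit_double_of_even hp, decide_eq_decide]
        omega
      · rw [uBit_double_of_odd hp, uBit_double_of_odd hp]
        exact hu _ (by omega) _ (by omega)

theorem bitCount_succ {h' h w' w : ℕ} (hh : 1 ≤ h) (hh' : h ≤ h') (hw : w + 1 ≤ w') :
    bitCount h' (h + 1) w' w = bitCount h' h w' w := by
  refine ncard_range_congr fun p q => ?_
  simp only [bitData_eq_iff]
  refine and_congr_right fun _ => and_congr_right fun _ => ⟨fun ⟨hv, hu⟩ =>
    ⟨hv, fun i hi => hu i (by omega)⟩, fun ⟨hv, hu⟩ => ⟨hv, fun i hi j hj => ?_⟩⟩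
  rcases Nat.lt_succ_iff_lt_or_eq.mp hi with hi | rfl
  · exact hu i hi j hj
  · obtain ⟨i, rfl⟩ := Nat.exists_eq_add_of_le' hh
    have h₀ := hv i (by omega) j (by omega)
    have h₁ := hv i (by omega) (j + 1) (by omega)
    simp only [← add_assoc] at h₁ ⊢
    rw [uBit_succ, uBit_succ, hu i (by omega) j hj, h₀, h₁]

theorem bitCount_eq_sum {h' h w' w : ℕ} (hh' : 2 ≤ h') (hh : 1 ≤ h) (hw' : 1 ≤ w')
    (hw : 2 ≤ w) :
    bitCount h' h w' w =
      bitCount (h' / 2) ((h + 1) / 2) ((w' + 1) / 2) (w / 2) +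
      bitCount (h' / 2) ((h + 1) / 2) (w' / 2 + 1) ((w + 1) / 2) +
      bitCount ((h' + 1) / 2) (h / 2 + 1) ((w' + 1) / 2) (w / 2) +
      bitCount ((h' + 1) / 2) (h / 2 + 1) (w' / 2 + 1) ((w + 1) / 2) := by
  let g (t : ℕ × ℕ) (p : ℕ × ℕ) := bitData h' h w' w (2 * p.1 + t.1, 2 * p.2 + t.2)
  have hg (t : ℕ × ℕ) (h₁ : t.1 < 2) (h₂ : t.2 < 2) : (Set.range (g t)).ncard =
      bitCount ((h' + t.1) / 2) ((h + t.1 + 1) / 2) ((w' + t.2 + 1) / 2) ((w + t.2) / 2) := by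
    refine ncard_range_congr fun p q => ?_
    rw [← sameBits_double_iff hh' hh hw' hw h₁ h₂, bitData_eq_iff]
    simp only [Nat.mul_add_mod, true_and]
  have hdisj (s t : ℕ × ℕ) (hs₁ : s.1 < 2) (hs₂ : s.2 < 2) (ht₁ : t.1 < 2) (ht₂ : t.2 < 2)
      (hst : s ≠ t) : Disjoint (Set.range (g s)) (Set.range (g t)) := by
    rw [Set.disjoint_left]
    rintro _ ⟨p, rfl⟩ ⟨q, hq⟩
    obtain ⟨h₁, h₂, -⟩ := bitData_eq_iff.mp hq
    exact hst (Prod.ext (by simp only at h₁; omega) (by simp only at h₂; omega))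
  have hunion : Set.range (bitData h' h w' w) = Set.range (g (0, 0)) ∪ Set.range (g (0, 1)) ∪
      Set.range (g (1, 0)) ∪ Set.range (g (1, 1)) := by
    refine Set.Subset.antisymm ?_ ?_
    · rintro _ ⟨⟨r, x⟩, rfl⟩
      have hmem : bitData h' h w' w (r, x) ∈ Set.range (g (r % 2, x % 2)) :=
        ⟨(r / 2, x / 2), by simp only [g, Nat.div_add_mod]⟩
      rcases Nat.mod_two_eq_zero_or_one r with hr | hr <;>
        rcases Nat.mod_two_eq_zero_or_one x with hx | hx <;>
        simp only [hr, hx] at hmem <;> simp only [Set.mem_union, hmem, true_or, or_true]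
    · simp only [Set.union_subset_iff]
      refine ⟨⟨⟨?_, ?_⟩, ?_⟩, ?_⟩ <;> rintro _ ⟨p, rfl⟩ <;> exact Set.mem_range_self _
  have hd₁ : Disjoint (Set.range (g (0, 0))) (Set.range (g (0, 1))) := by
    apply hdisj <;> simp
  have hd₂ : Disjoint (Set.range (g (0, 0)) ∪ Set.range (g (0, 1))) (Set.range (g (1, 0))) := by
    rw [Set.disjoint_union_left]
    constructor <;> apply hdisj <;> simp
  have hd₃ : Disjoint (Set.range (g (0, 0)) ∪ Set.range (g (0, 1)) ∪ Set.range (g (1, 0)))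
      (Set.range (g (1, 1))) := by
    rw [Set.disjoint_union_left, Set.disjoint_union_left]
    refine ⟨⟨?_, ?_⟩, ?_⟩ <;> apply hdisj <;> simp
  rw [bitCount, hunion, Set.ncard_union_eq hd₃, Set.ncard_union_eq hd₂, Set.ncard_union_eq hd₁,
    hg _ (by simp) (by simp), hg _ (by simp) (by simp), hg _ (by simp) (by simp),
    hg _ (by simp) (by simp)]
  simp only [add_zero, show (h + 1 + 1) / 2 = h / 2 + 1 by omega,
    show (w' + 1 + 1) / 2 = w' / 2 + 1 by omega]

theorem card_Pij {i j m n : ℕ} (hi : i = 1 ∨ i = 2) (hj : j = 1 ∨ j = 2) (hm : 2 ≤ m)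
    (hn : 2 ≤ n) :
    Nat.card (Pij i j m n) = bitCount ((m + (i - 1)) / 2) ((m + (i - 1) + 1) / 2)
      ((n + (n + 1 - j) % 2 + 1) / 2) ((n + (n + 1 - j) % 2) / 2) := by
  rw [Nat.card_coe_set_eq, Pij_eq_range m n hi hj]
  refine ncard_range_congr fun p q => ?_
  rw [window_eq_iff (by omega) (by omega)]
  exact sameBits_double_iff hm (by omega) (by omega) hn (by omega) (by omega) p q

theorem card_Pij_eq_bitCount {i j m n h' h w' w : ℕ} (hi : i = 1 ∨ i = 2) (hj : j = 1 ∨ j = 2)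
    (hm : 2 ≤ m) (hn : 2 ≤ n) (h₁ : (m + (i - 1)) / 2 = h') (h₂ : (m + (i - 1) + 1) / 2 = h)
    (h₃ : (n + (n + 1 - j) % 2 + 1) / 2 = w') (h₄ : (n + (n + 1 - j) % 2) / 2 = w) :
    Nat.card (Pij i j m n) = bitCount h' h w' w := by
  rw [card_Pij hi hj hm hn, h₁, h₂, h₃, h₄]

theorem bitCount_eq_sum_of_eq {h' h w' w p' p s' s t' t z' z : ℕ} (hh' : 2 ≤ h') (hh : 1 ≤ h)
    (hw' : 1 ≤ w') (hw : 2 ≤ w) (h₁ : h' / 2 = p') (h₂ : (h + 1) / 2 = p)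
    (h₃ : (h' + 1) / 2 = s') (h₄ : h / 2 + 1 = s) (h₅ : (w' + 1) / 2 = t') (h₆ : w / 2 = t)
    (h₇ : w' / 2 + 1 = z') (h₈ : (w + 1) / 2 = z) :
    bitCount h' h w' w =
      bitCount p' p t' t + bitCount p' p z' z + bitCount s' s t' t + bitCount s' s z' z := by
  rw [bitCount_eq_sum hh' hh hw' hw, h₁, h₂, h₃, h₄, h₅, h₆, h₇, h₈]

theorem card_Pij_congr {i j m n i' j' m' n' : ℕ} (hi : i = 1 ∨ i = 2) (hj : j = 1 ∨ j = 2)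
    (hm : 2 ≤ m) (hn : 2 ≤ n) (hi' : i' = 1 ∨ i' = 2) (hj' : j' = 1 ∨ j' = 2)
    (hm' : 2 ≤ m') (hn' : 2 ≤ n') (h₁ : (m + (i - 1)) / 2 = (m' + (i' - 1)) / 2)
    (h₂ : (m + (i - 1) + 1) / 2 = (m' + (i' - 1) + 1) / 2)
    (h₃ : (n + (n + 1 - j) % 2 + 1) / 2 = (n' + (n' + 1 - j') % 2 + 1) / 2)
    (h₄ : (n + (n + 1 - j) % 2) / 2 = (n' + (n' + 1 - j') % 2) / 2) :
    Nat.card (Pij i j m n) = Nat.card (Pij i' j' m' n') := by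
  rw [card_Pij hi hj hm hn, card_Pij hi' hj' hm' hn', h₁, h₂, h₃, h₄]

/-- The system of recursions for the quantities c_{i,j}. -/
theorem recursion_system_c (n : ℕ) (hn : 1 ≤ n) :
    (cT 1 1 (4 * n) = aT 2 1 (4 * n)) ∧
    (cT 1 2 (4 * n) = aT 2 2 (4 * n)) ∧
    (cT 2 1 (4 * n) =
        aT 2 1 (2 * n) + aT 1 2 (2 * n) + cT 2 1 (2 * n) + aT 2 2 (2 * n + 1)) ∧
    (cT 2 2 (4 * n) = aT 2 2 (4 * n + 1)) ∧
    (cT 1 1 (4 * n + 1) = aT 2 1 (4 * n + 1)) ∧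
    (cT 1 2 (4 * n + 1) = aT 2 2 (4 * n + 1)) ∧
    (cT 2 1 (4 * n + 1) = aT 2 1 (4 * n + 2)) ∧
    (cT 2 2 (4 * n + 1) = 2 * aT 1 2 (2 * n) + 2 * aT 2 2 (2 * n + 1)) ∧
    (cT 1 1 (4 * n + 2) = aT 2 1 (4 * n + 2)) ∧
    (cT 1 2 (4 * n + 2) = aT 2 2 (4 * n + 2)) ∧
    (cT 2 1 (4 * n + 2) =
        aT 1 1 (2 * n + 2) + 2 * aT 2 2 (2 * n + 1) + aT 2 1 (2 * n + 2)) ∧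
    (cT 2 2 (4 * n + 2) = aT 2 2 (4 * n + 3)) ∧
    (cT 1 1 (4 * n + 3) = aT 2 1 (4 * n + 3)) ∧
    (cT 1 2 (4 * n + 3) = aT 2 2 (4 * n + 3)) ∧
    (cT 2 1 (4 * n + 3) = 2 * aT 2 1 (2 * n + 2) + 2 * aT 1 2 (2 * n + 2)) ∧
    (cT 2 2 (4 * n + 3) = 2 * aT 2 2 (2 * n + 1) + 2 * aT 1 2 (2 * n + 2)) := by
  have a21 : aT 2 1 (2 * n) = bitCount n (n + 1) n n := by
    apply card_Pij_eq_bitCount <;> omega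
  have a12 : aT 1 2 (2 * n) = bitCount n n (n + 1) n := by
    apply card_Pij_eq_bitCount <;> omega
  have c21 : cT 2 1 (2 * n) = bitCount (n + 1) (n + 1) n n := by
    apply card_Pij_eq_bitCount <;> omega
  have a22_1 : aT 2 2 (2 * n + 1) = bitCount (n + 1) (n + 1) (n + 1) n := by
    apply card_Pij_eq_bitCount <;> omega
  have a11_2 : aT 1 1 (2 * n + 2) = bitCount (n + 1) (n + 1) (n + 1) (n + 1) := by
    apply card_Pij_eq_bitCount <;> omega
  have a21_2 : aT 2 1 (2 * n + 2) = bitCount (n + 1) (n + 2) (n + 1) (n + 1) := by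
    apply card_Pij_eq_bitCount <;> omega
  have a12_2 : aT 1 2 (2 * n + 2) = bitCount (n + 1) (n + 1) (n + 2) (n + 1) := by
    apply card_Pij_eq_bitCount <;> omega
  have c21_four : cT 2 1 (4 * n) =
      bitCount n (n + 1) n n + bitCount n (n + 1) (n + 1) n +
        bitCount (n + 1) (n + 1) n n + bitCount (n + 1) (n + 1) (n + 1) n := by
    trans bitCount (2 * n + 1) (2 * n + 1) (2 * n) (2 * n)
    · apply card_Pij_eq_bitCount <;> omega
    · apply bitCount_eq_sum_of_eq <;> omega
  have c22_four_1 : cT 2 2 (4 * n + 1) =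
      bitCount n (n + 1) (n + 1) n + bitCount n (n + 1) (n + 1) n +
        bitCount (n + 1) (n + 2) (n + 1) n + bitCount (n + 1) (n + 2) (n + 1) n := by
    trans bitCount (2 * n + 1) (2 * n + 2) (2 * n + 1) (2 * n)
    · apply card_Pij_eq_bitCount <;> omega
    · apply bitCount_eq_sum_of_eq <;> omega
  have c21_four_2 : cT 2 1 (4 * n + 2) =
      bitCount (n + 1) (n + 1) (n + 1) n + bitCount (n + 1) (n + 1) (n + 1) (n + 1) +
        bitCount (n + 1) (n + 2) (n + 1) n + bitCount (n + 1) (n + 2) (n + 1) (n + 1) := by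
    trans bitCount (2 * n + 2) (2 * n + 2) (2 * n + 1) (2 * n + 1)
    · apply card_Pij_eq_bitCount <;> omega
    · apply bitCount_eq_sum_of_eq <;> omega
  have c21_four_3 : cT 2 1 (4 * n + 3) =
      bitCount (n + 1) (n + 2) (n + 1) (n + 1) + bitCount (n + 1) (n + 2) (n + 2) (n + 1) +
        bitCount (n + 1) (n + 2) (n + 1) (n + 1) + bitCount (n + 1) (n + 2) (n + 2) (n + 1) := by
    trans bitCount (2 * n + 2) (2 * n + 3) (2 * n + 2) (2 * n + 2)
    · apply card_Pij_eq_bitCount <;> omega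
    · apply bitCount_eq_sum_of_eq <;> omega
  have c22_four_3 : cT 2 2 (4 * n + 3) =
      bitCount (n + 1) (n + 2) (n + 1) n + bitCount (n + 1) (n + 2) (n + 2) (n + 1) +
        bitCount (n + 1) (n + 2) (n + 1) n + bitCount (n + 1) (n + 2) (n + 2) (n + 1) := by
    trans bitCount (2 * n + 2) (2 * n + 3) (2 * n + 2) (2 * n + 1)
    · apply card_Pij_eq_bitCount <;> omega
    · apply bitCount_eq_sum_of_eq <;> omega
  have hsucc : bitCount n (n + 1) (n + 1) n = bitCount n n (n + 1) n :=
    bitCount_succ hn le_rfl le_rfl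
  have hsucc_wide : bitCount (n + 1) (n + 2) (n + 2) (n + 1) =
      bitCount (n + 1) (n + 1) (n + 2) (n + 1) :=
    bitCount_succ (by omega) le_rfl le_rfl
  have hsucc_square : bitCount (n + 1) (n + 2) (n + 1) n = bitCount (n + 1) (n + 1) (n + 1) n :=
    bitCount_succ (by omega) le_rfl le_rfl
  refine ⟨?_, ?_, ?_, ?_, ?_, ?_, ?_, ?_, ?_, ?_, ?_, ?_, ?_, ?_, ?_, ?_⟩
  · apply card_Pij_congr <;> omega
  · apply card_Pij_congr <;> omega
  · omega
  · apply card_Pij_congr <;> omega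
  · apply card_Pij_congr <;> omega
  · apply card_Pij_congr <;> omega
  · apply card_Pij_congr <;> omega
  · omega
  · apply card_Pij_congr <;> omega
  · apply card_Pij_congr <;> omega
  · omega
  · apply card_Pij_congr <;> omega
  · apply card_Pij_congr <;> omega
  · apply card_Pij_congr <;> omega
  · omega
  · omega
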